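/- arXiv:1601.00352 — 3 statements merged into one kernel-verified Lean document; each statement's English description precedes it below -/
import Mathlib

section
/- Let L be a Lie algebra over a field K that contains no two-dimensional subalgebra (every Lie subalgebra S of L satisfies dim_K S ≠ 2). If x, y ∈ L are such that (ad x)^n y = 0 for some natural number n, then x and y are linearly dependent over K. -/
universe u

/-- The span of `x` and `y` is a Lie subalgebra as soon as `⁅x, y⁆` is a multiple of `x`. -/
theorem exists_lieSubalgebra_toSubmodule_eq_span_pair {K L : Type*} [CommRing K] [LieRing L]
    [LieAlgebra K L] {x y : L} {c : K} (hc : ⁅x, y⁆ = c • x) :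
    ∃ S : LieSubalgebra K L, S.toSubmodule = Submodule.span K {x, y} := by
  refine ⟨{ Submodule.span K {x, y} with lie_mem' := ?_ }, rfl⟩
  intro u v hu hv
  obtain ⟨a, b, rfl⟩ := Submodule.mem_span_pair.1 hu
  obtain ⟨a', b', rfl⟩ := Submodule.mem_span_pair.1 hv
  have hyx : ⁅y, x⁆ = -(c • x) := by rw [← lie_skew, hc]
  refine Submodule.mem_span_pair.2 ⟨(a * b' - b * a') * c, 0, ?_⟩
  simp only [lie_add, add_lie, lie_smul, smul_lie, lie_self, hc, hyx]
  module

theorem finrank_span_pair_eq_two {K V : Type*} [Field K] [AddCommGroup V] [Module K V] {x y : V}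
    (hxy : LinearIndependent K ![x, y]) : Module.finrank K (Submodule.span K {x, y}) = 2 := by
  rw [← Matrix.range_cons_cons_empty x y ![], finrank_span_eq_card hxy, Fintype.card_fin]

theorem mem_span_singleton_of_ad_pow_eq_zero {K L : Type*} [Field K] [LieRing L] [LieAlgebra K L]
    (h : ∀ S : LieSubalgebra K L, Module.finrank K S ≠ 2) {x : L} (hx : x ≠ 0) (n : ℕ) (y : L)
    (hxy : ((LieAlgebra.ad K L x) ^ n) y = 0) : ∃ c : K, c • x = y := by
  induction n generalizing y with
  | zero => exact ⟨0, by simpa [eq_comm] using hxy⟩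
  | succ n ih =>
    obtain ⟨c, hc⟩ := ih ⁅x, y⁆ (by simpa [pow_succ] using hxy)
    obtain ⟨S, hS⟩ := exists_lieSubalgebra_toSubmodule_eq_span_pair hc.symm
    by_contra! hy
    apply h S
    change Module.finrank K S.toSubmodule = 2
    rw [hS]
    exact finrank_span_pair_eq_two ((LinearIndependent.pair_iff' hx).2 hy)

/-- In a Lie algebra without two-dimensional subalgebras, if `(ad x)^n y = 0` for some
`n`, then `x` and `y` are linearly dependent. -/
theorem linearDependent_of_ad_pow_eq_zero (K : Type u) [Field K] (L : Type u)
    [LieRing L] [LieAlgebra K L]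
    (h : ∀ S : LieSubalgebra K L, Module.finrank K S ≠ 2)
    (x y : L) (n : ℕ) (hxy : ((LieAlgebra.ad K L x) ^ n) y = 0) :
    ¬ LinearIndependent K ![x, y] := by
  intro hli
  have hx : x ≠ 0 := hli.ne_zero 0
  obtain ⟨c, hc⟩ := mem_span_singleton_of_ad_pow_eq_zero h hx n y hxy
  exact (LinearIndependent.pair_iff' hx).1 hli c hc
end

section
/- Let K be an algebraically closed field of prime characteristic p, and let L be a Lie algebra over K with dim_K L > 1 (including the infinite-dimensional case), equipped with a map P : L → L satisfying ad(P x) = (ad x)^p for all x ∈ L. Then L contains a two-dimensional subalgebra, i.e., there exists a Lie subalgebra S of L with dim_K S = 2. (A Lie p-algebra of dimension > 1 over an algebraically closed field contains a two-dimensional subalgebra.) -/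
open Polynomial in
/-- If a product of linear factors in `f` sends a vector outside `W` into `W`, then `f` has an
eigenvector modulo `W`. -/
theorem Module.End.exists_notMem_sub_smul_mem {K V : Type*} [Field K] [AddCommGroup V] [Module K V]
    (f : Module.End K V) (W : Submodule K V) (s : Multiset K) (v : V) (hv : v ∉ W)
    (h : aeval f (s.map fun a => X - C a).prod v ∈ W) :
    ∃ (a : K) (w : V), w ∉ W ∧ f w - a • w ∈ W := by
  induction s using Multiset.induction_on with
  | empty => exact absurd (by simpa using h) hv
  | cons a s ih =>
    by_cases hw : aeval f (s.map fun a => X - C a).prod v ∈ W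
    · exact ih hw
    · exact ⟨a, _, hw, by simpa [Module.algebraMap_end_apply] using h⟩

/-- Two linearly independent elements whose bracket lies in their span generate a
two-dimensional subalgebra. -/
theorem LieSubalgebra.exists_finrank_eq_two {K L : Type*} [Field K] [LieRing L] [LieAlgebra K L]
    {x y : L} (hxy : LinearIndependent K ![x, y]) (h : ⁅x, y⁆ ∈ Submodule.span K {x, y}) :
    ∃ S : LieSubalgebra K L, Module.finrank K S = 2 := by
  refine ⟨{ Submodule.span K {x, y} with lie_mem' := ?_ }, ?_⟩
  · intro u v hu hv
    obtain ⟨a, b, rfl⟩ := Submodule.mem_span_pair.1 hu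
    obtain ⟨c, d, rfl⟩ := Submodule.mem_span_pair.1 hv
    have key : ⁅a • x + b • y, c • x + d • y⁆ = (a * d - b * c) • ⁅x, y⁆ := by
      simp only [add_lie, lie_add, smul_lie, lie_smul, lie_self, smul_zero, ← lie_skew x y]
      module
    change ⁅a • x + b • y, c • x + d • y⁆ ∈ Submodule.span K {x, y}
    rw [key]
    exact Submodule.smul_mem _ _ h
  · change Module.finrank K (Submodule.span K {x, y}) = 2
    rw [← Matrix.range_cons_cons_empty x y ![], finrank_span_eq_card hxy, Fintype.card_fin]

open Polynomial in
/-- A Lie `p`-algebra of dimension `> 1` (possibly infinite-dimensional) over an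
algebraically closed field of characteristic `p` contains a two-dimensional subalgebra. -/
theorem exists_twoDim_subalgebra (K : Type u) [Field K] [IsAlgClosed K] (L : Type u)
    [LieRing L] [LieAlgebra K L] (p : ℕ) [Fact p.Prime] [CharP K p]
    (P : L → L) (hP : ∀ x : L, LieAlgebra.ad K L (P x) = (LieAlgebra.ad K L x) ^ p)
    (hdim : 1 < Module.rank K L) :
    ∃ S : LieSubalgebra K L, Module.finrank K S = 2 := by
  have hp : 1 < p := (Fact.out : p.Prime).one_lt
  have : Nontrivial L := rank_pos_iff_nontrivial.1 (zero_lt_one.trans hdim)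
  obtain ⟨x, hx⟩ := exists_ne (0 : L)
  obtain ⟨y, hxy⟩ := exists_linearIndependent_pair_of_one_lt_rank hdim hx
  by_cases hPx : LinearIndependent K ![x, P x]
  · refine LieSubalgebra.exists_finrank_eq_two hPx ?_
    have h0 : ⁅P x, x⁆ = 0 := by
      obtain ⟨n, rfl⟩ := Nat.exists_eq_succ_of_ne_zero (by omega : p ≠ 0)
      rw [← LieAlgebra.ad_apply K, hP, pow_succ]
      simp
    rw [← lie_skew, h0, neg_zero]
    exact Submodule.zero_mem _
  · obtain ⟨c, hc⟩ : ∃ c : K, c • x = P x := by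
      simpa [LinearIndependent.pair_iff' hx] using hPx
    have hdeg : (C c * X : K[X]).degree < p :=
      (degree_C_mul_X_le c).trans_lt (by exact_mod_cast hp)
    have hmonic : (X ^ p - C c * X : K[X]).Monic := monic_X_pow_sub hdeg
    have hsplit := (IsAlgClosed.splits (X ^ p - C c * X : K[X])).eq_prod_roots_of_monic hmonic
    have hzero : aeval (LieAlgebra.ad K L x) (X ^ p - C c * X : K[X]) = 0 := by
      ext z
      simp [← hP, ← hc, Module.algebraMap_end_apply]
    have hy : y ∉ Submodule.span K {x} := by
      simpa [Submodule.mem_span_singleton] using (LinearIndependent.pair_iff' hx).1 hxy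
    obtain ⟨a, w, hw, haw⟩ := Module.End.exists_notMem_sub_smul_mem (LieAlgebra.ad K L x)
      (Submodule.span K {x}) (X ^ p - C c * X : K[X]).roots y hy (by rw [← hsplit, hzero]; simp)
    obtain ⟨b, hb⟩ := Submodule.mem_span_singleton.1 haw
    refine LieSubalgebra.exists_finrank_eq_two (x := x) (y := w) ?_ ?_
    · simpa [LinearIndependent.pair_iff' hx, Submodule.mem_span_singleton] using hw
    · exact Submodule.mem_span_pair.2 ⟨b, a, by rw [hb, LieAlgebra.ad_apply]; abel⟩
end

section
/- Let K be a field of prime characteristic p, let n ≥ 1, and let f(X) = λ_1 X^p + λ_2 X^{p^2} + ⋯ + λ_n X^{p^n} ∈ K[X] with λ_n ≠ 0 (so f is a nonzero polynomial whose formal derivative is zero). Set A = K[X]/(f). Then the Hochschild cohomology of A does not vanish in any degree: for every natural number m, Ext^m_{A ⊗_K A}(A, A) ≠ 0, where A is regarded as a module over the ring A ⊗_K A via the multiplication map a ⊗ b ↦ ab. -/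
open CategoryTheory Polynomial TensorProduct

universe u

/-- The quotient algebra `A = K[X]/(f)`. -/
abbrev QuotPolyAlg (K : Type u) [Field K] (f : Polynomial K) : Type u :=
  Polynomial K ⧸ Ideal.span {f}

set_option synthInstance.maxHeartbeats 1000000 in
/-- `A = K[X]/(f)` regarded as a module over `A ⊗[K] A` via the multiplication map
`a ⊗ b ↦ a * b`. -/
noncomputable def hochschildBimodule (K : Type u) [Field K] (f : Polynomial K) :
    ModuleCat.{u} (QuotPolyAlg K f ⊗[K] QuotPolyAlg K f) :=
  @ModuleCat.of (QuotPolyAlg K f ⊗[K] QuotPolyAlg K f) _ (QuotPolyAlg K f) _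
    (Module.compHom (QuotPolyAlg K f)
      ((Algebra.TensorProduct.lmul' K :
        QuotPolyAlg K f ⊗[K] QuotPolyAlg K f →ₐ[K] QuotPolyAlg K f)).toRingHom)

namespace CategoryTheory

variable {C : Type*} [Category* C] [Abelian C] {X M : C} [Projective X] {φ ψ : X ⟶ X} {π : X ⟶ M}

/-- The periodic projective resolution of `M` with all terms `X`, differentials alternating
between `ψ` and `φ`, and augmentation `π`. -/
noncomputable def ProjectiveResolution.ofPeriodic [Epi π] (hφψ : φ ≫ ψ = 0) (hψφ : ψ ≫ φ = 0)
    (hψπ : ψ ≫ π = 0) (exφψ : (ShortComplex.mk φ ψ hφψ).Exact)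
    (exψφ : (ShortComplex.mk ψ φ hψφ).Exact) (exψπ : (ShortComplex.mk ψ π hψπ).Exact) :
    ProjectiveResolution M :=
  let P : ChainComplex C ℕ := HomologicalComplex.alternatingConst X hφψ hψφ
    fun _ _ => ComplexShape.down_nat_odd_add
  have hP : P.d 1 0 ≫ π = 0 := hψπ
  { complex := P
    projective := fun _ => inferInstanceAs (Projective X)
    π := (P.toSingle₀Equiv M).symm ⟨π, hP⟩
    quasiIso := ⟨fun n => by
      cases n with
      | zero =>
        rw [ChainComplex.quasiIsoAt₀_iff, ShortComplex.quasiIso_iff_of_zeros' _ rfl rfl rfl]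
        refine (ShortComplex.exact_and_epi_g_iff_of_iso ?_).2 ⟨exψπ, inferInstanceAs (Epi π)⟩
        exact ShortComplex.isoMk (Iso.refl _) (Iso.refl _) (Iso.refl _)
          ((Category.id_comp ψ).trans (Category.comp_id ψ).symm)
          ((Category.id_comp π).trans
            (((Category.comp_id _).trans (P.toSingle₀Equiv_symm_apply_f_zero π hP)).symm))
      | succ m =>
        rw [quasiIsoAt_iff_exactAt' (hL := ChainComplex.exactAt_succ_single_obj ..),
          HomologicalComplex.exactAt_iff' _ (m + 2) (m + 1) m (by simp) (by simp)]
        rcases Nat.even_or_odd (m + 1) with h | h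
        · exact (ShortComplex.exact_iff_of_iso (HomologicalComplex.alternatingConstScIsoEven X hφψ
            hψφ _ (by simp) (by simp) h)).2 exψφ
        · exact (ShortComplex.exact_iff_of_iso (HomologicalComplex.alternatingConstScIsoOdd X hφψ
            hψφ _ (by simp) (by simp) h)).2 exφψ⟩ }

/-- If every differential of a projective resolution of `M` is killed by maps to `Y`, then
`Extⁿ(M, Y)` is the module of maps from the `n`-th term of the resolution to `Y`. -/
noncomputable def ProjectiveResolution.isoExtOfCompEqZero {R : Type*} [Ring R] [Linear R C]
    [EnoughProjectives C] {M : C} (P : ProjectiveResolution M) (Y : C)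
    (h : ∀ i j (g : P.complex.X j ⟶ Y), P.complex.d i j ≫ g = 0) (n : ℕ) :
    ((Ext R C n).obj (Opposite.op M)).obj Y ≅ ModuleCat.of R (P.complex.X n ⟶ Y) :=
  have hd (i j : ℕ) : (P.complex.linearYonedaObj R Y).d i j = 0 := by
    ext g
    exact h j i g
  P.isoExt n Y ≪≫ (ShortComplex.HomologyData.ofZeros
    ((P.complex.linearYonedaObj R Y).sc n) (hd _ _) (hd _ _)).left.homologyIso

end CategoryTheory

theorem nontrivial_Ext_of_exact_pair {k R M : Type u} [Field k] [CommRing R] [Algebra k R]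
    [AddCommGroup M] [Module R M] [Nontrivial M] {a b : R} {π : R →ₗ[R] M}
    (hab : Function.Exact (LinearMap.mulLeft R a) (LinearMap.mulLeft R b))
    (hba : Function.Exact (LinearMap.mulLeft R b) (LinearMap.mulLeft R a))
    (hbπ : Function.Exact (LinearMap.mulLeft R b) π) (hπ : Function.Surjective π)
    (ha : ∀ x : M, a • x = 0) (n : ℕ) :
    Nontrivial (((Ext k (ModuleCat.{u} R) n).obj (Opposite.op (ModuleCat.of R M))).obj
      (ModuleCat.of R M)) := by
  have hb (x : M) : b • x = 0 := by
    obtain ⟨r, rfl⟩ := hπ x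
    rw [← map_smul]
    exact (hbπ _).2 ⟨r, rfl⟩
  have : Epi (ModuleCat.ofHom π) := (ModuleCat.epi_iff_surjective _).2 hπ
  have hz {X Y Z : Type u} [AddCommGroup X] [Module R X] [AddCommGroup Y] [Module R Y]
      [AddCommGroup Z] [Module R Z] {f : X →ₗ[R] Y} {g : Y →ₗ[R] Z} (h : Function.Exact f g) :
      ModuleCat.ofHom f ≫ ModuleCat.ofHom g = 0 := by
    ext x
    exact h.apply_apply_eq_zero x
  have hex {X Y Z : Type u} [AddCommGroup X] [Module R X] [AddCommGroup Y] [Module R Y]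
      [AddCommGroup Z] [Module R Z] {f : X →ₗ[R] Y} {g : Y →ₗ[R] Z} (h : Function.Exact f g) :
      (ShortComplex.mk _ _ (hz h)).Exact :=
    (ShortComplex.ShortExact.moduleCat_exact_iff_function_exact _).2 h
  have : Projective (ModuleCat.of R R) := inferInstance
  let P := ProjectiveResolution.ofPeriodic (hz hab) (hz hba) (hz hbπ) (hex hab) (hex hba) (hex hbπ)
  have h (i j : ℕ) (g : P.complex.X j ⟶ ModuleCat.of R M) : P.complex.d i j ≫ g = 0 := by
    have hzero {c : R} (hc : ∀ x : M, c • x = 0) (g : ModuleCat.of R R ⟶ ModuleCat.of R M) :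
        ModuleCat.ofHom (LinearMap.mulLeft R c) ≫ g = 0 := by
      ext
      exact (g.hom.map_smul c _).trans (hc _)
    by_cases hij : (ComplexShape.down ℕ).Rel i j
    · have hd : P.complex.d i j = if Even i then ModuleCat.ofHom (LinearMap.mulLeft R a)
          else ModuleCat.ofHom (LinearMap.mulLeft R b) := dif_pos hij
      rw [hd]
      split_ifs
      exacts [hzero ha g, hzero hb g]
    · rw [P.complex.shape i j hij, Limits.zero_comp]
  have e : (((Ext k (ModuleCat.{u} R) n).obj (Opposite.op (ModuleCat.of R M))).obj
      (ModuleCat.of R M)) ≃ (ModuleCat.of R R ⟶ ModuleCat.of R M) :=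
    (P.isoExtOfCompEqZero (R := k) _ h n).toLinearEquiv.toEquiv
  have : Nontrivial (ModuleCat.of R R ⟶ ModuleCat.of R M) :=
    (ModuleCat.homEquiv.trans (LinearMap.ringLmapEquivSelf R R M).toEquiv).nontrivial
  exact e.nontrivial

theorem Function.Exact.mulLeft_ringEquiv {R S : Type*} [CommRing R] [CommRing S] (e : R ≃+* S)
    {a b : R} (h : Function.Exact (LinearMap.mulLeft R a) (LinearMap.mulLeft R b)) :
    Function.Exact (LinearMap.mulLeft S (e a)) (LinearMap.mulLeft S (e b)) := by
  intro y
  obtain ⟨y, rfl⟩ := e.surjective y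
  have := h y
  simp only [LinearMap.mulLeft_apply, Set.mem_range, ← map_mul, EmbeddingLike.map_eq_zero_iff]
    at this ⊢
  rw [this]
  constructor
  · rintro ⟨d, rfl⟩
    exact ⟨e d, (map_mul e a d).symm⟩
  · rintro ⟨d, hd⟩
    exact ⟨e.symm d, e.injective (by simpa using hd)⟩

theorem Function.Exact.mulLeft_one_tmul {K A B : Type*} [Field K] [CommRing A] [Algebra K A]
    [CommRing B] [Algebra K B] {a b : B}
    (h : Function.Exact (LinearMap.mulLeft B a) (LinearMap.mulLeft B b)) :
    Function.Exact (LinearMap.mulLeft (A ⊗[K] B) ((1 : A) ⊗ₜ[K] a))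
      (LinearMap.mulLeft (A ⊗[K] B) ((1 : A) ⊗ₜ[K] b)) := by
  have key (c : B) : ⇑(LinearMap.mulLeft (A ⊗[K] B) ((1 : A) ⊗ₜ[K] c)) =
      (LinearMap.mulLeft K c).lTensor A := by
    have : LinearMap.mulLeft K ((1 : A) ⊗ₜ[K] c) = (LinearMap.mulLeft K c).lTensor A := by
      ext; simp
    rw [← this]
    rfl
  rw [key, key]
  exact Module.Flat.lTensor_exact A (f := LinearMap.mulLeft K a) (g := LinearMap.mulLeft K b) h

namespace IsAdjoinRoot

section Exact

variable {R A : Type*} [CommRing R] [IsDomain R] [CommRing A] [Algebra R A] {f : R[X]}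

theorem exact_mulLeft_map (h : IsAdjoinRoot A f) {q r : R[X]} (hq : q ≠ 0) (hqr : q * r = f) :
    Function.Exact (LinearMap.mulLeft A (h.map r)) (LinearMap.mulLeft A (h.map q)) := by
  intro c
  obtain ⟨c, rfl⟩ := h.map_surjective c
  simp only [LinearMap.mulLeft_apply, Set.mem_range]
  constructor
  · rw [← map_mul, map_eq_zero_iff]
    rintro ⟨d, hd⟩
    rw [← hqr, mul_assoc] at hd
    exact ⟨h.map d, by rw [← map_mul, mul_left_cancel₀ hq hd]⟩
  · rintro ⟨d, hd⟩
    rw [← hd, ← mul_assoc, ← map_mul, hqr, map_self, zero_mul]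

end Exact

variable {K : Type*} {A : Type*} [Field K] [CommRing A] [Algebra K A] {f : K[X]}
  (h : IsAdjoinRoot A f)

/-- The element `x ⊗ 1 - 1 ⊗ x` of `A ⊗ A`, where `x` is the root of `f` generating `A`. -/
noncomputable def rootDiff : A ⊗[K] A := h.root ⊗ₜ 1 - 1 ⊗ₜ h.root

theorem aeval_root_tmul_one (q : K[X]) :
    aeval (h.root ⊗ₜ[K] (1 : A)) q = h.map q ⊗ₜ 1 := by
  rw [← aeval_root_eq_map]
  exact aeval_algHom_apply (Algebra.TensorProduct.includeLeft : A →ₐ[K] A ⊗[K] A) h.root q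

theorem aeval_one_tmul_root (q : K[X]) :
    aeval ((1 : A) ⊗ₜ[K] h.root) q = 1 ⊗ₜ h.map q := by
  rw [← aeval_root_eq_map]
  exact aeval_algHom_apply (Algebra.TensorProduct.includeRight : A →ₐ[K] A ⊗[K] A) h.root q

/-- The endomorphism of `A ⊗ A` fixing `x ⊗ 1` and sending `1 ⊗ x` to `x ⊗ 1 - 1 ⊗ x`. -/
noncomputable def shearHom (hf : aeval h.rootDiff f = 0) : A ⊗[K] A →ₐ[K] A ⊗[K] A :=
  Algebra.TensorProduct.productMap Algebra.TensorProduct.includeLeft (h.liftHom h.rootDiff hf)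

theorem shearHom_one_tmul (hf : aeval h.rootDiff f = 0) (a : A) :
    h.shearHom hf (1 ⊗ₜ a) = h.liftHom h.rootDiff hf a := by
  simp [shearHom, ← Algebra.TensorProduct.one_def]

theorem shearHom_tmul_one (hf : aeval h.rootDiff f = 0) (a : A) :
    h.shearHom hf (a ⊗ₜ 1) = a ⊗ₜ 1 := by
  simp [shearHom]

theorem shearHom_comp_self (hf : aeval h.rootDiff f = 0) :
    (h.shearHom hf).comp (h.shearHom hf) = AlgHom.id K _ := by
  apply Algebra.TensorProduct.ext
  · ext a
    simp [shearHom_tmul_one]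
  · have h1 : aeval ((1 : A) ⊗ₜ[K] h.root) f = 0 := by
      rw [aeval_one_tmul_root, map_self, tmul_zero]
    exact (h.eq_liftHom h1 _ (by
      simp [shearHom_tmul_one, shearHom_one_tmul, rootDiff])).trans
        (h.eq_liftHom h1 _ (by simp)).symm

/-- The involutive automorphism of `A ⊗ A` fixing `x ⊗ 1` and sending `1 ⊗ x` to
`x ⊗ 1 - 1 ⊗ x`. -/
noncomputable def shear (hf : aeval h.rootDiff f = 0) : A ⊗[K] A ≃ₐ[K] A ⊗[K] A :=
  AlgEquiv.ofAlgHom (h.shearHom hf) (h.shearHom hf) (h.shearHom_comp_self hf)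
    (h.shearHom_comp_self hf)

theorem shear_one_tmul_map (hf : aeval h.rootDiff f = 0) (q : K[X]) :
    h.shear hf (1 ⊗ₜ h.map q) = aeval h.rootDiff q :=
  (h.shearHom_one_tmul hf _).trans (h.liftHom_map hf q)

theorem exact_mulLeft_aeval_rootDiff (hf : aeval h.rootDiff f = 0) {q r : K[X]} (hq : q ≠ 0)
    (hqr : q * r = f) :
    Function.Exact (LinearMap.mulLeft (A ⊗[K] A) (aeval h.rootDiff r))
      (LinearMap.mulLeft (A ⊗[K] A) (aeval h.rootDiff q)) := by
  rw [← h.shear_one_tmul_map hf, ← h.shear_one_tmul_map hf]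
  exact ((h.exact_mulLeft_map hq hqr).mulLeft_one_tmul).mulLeft_ringEquiv (h.shear hf).toRingEquiv

theorem exact_mulLeft_rootDiff_lmul' :
    Function.Exact (LinearMap.mulLeft (A ⊗[K] A) h.rootDiff)
      (Algebra.TensorProduct.lmul' K : A ⊗[K] A →ₐ[K] A) := by
  intro z
  constructor
  · intro hz
    have hz : z ∈ KaehlerDifferential.ideal K A := hz
    rw [← KaehlerDifferential.span_range_eq_ideal] at hz
    suffices Ideal.span (Set.range fun s : A => (1 : A) ⊗ₜ[K] s - s ⊗ₜ[K] (1 : A)) ≤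
        Ideal.span {h.rootDiff} by
      obtain ⟨d, hd⟩ := Ideal.mem_span_singleton'.1 (this hz)
      exact ⟨d, (mul_comm _ _).trans hd⟩
    rw [Ideal.span_le]
    rintro _ ⟨s, rfl⟩
    obtain ⟨q, rfl⟩ := h.map_surjective s
    have hd := sub_dvd_eval_sub (h.root ⊗ₜ[K] (1 : A)) ((1 : A) ⊗ₜ[K] h.root)
      (q.map (algebraMap K (A ⊗[K] A)))
    rw [eval_map_algebraMap, eval_map_algebraMap, aeval_root_tmul_one, aeval_one_tmul_root] at hd
    exact Ideal.mem_span_singleton.2 ((dvd_neg.2 hd).trans (neg_sub _ _).dvd)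
  · rintro ⟨d, rfl⟩
    simp [rootDiff]

theorem lmul'_aeval_rootDiff (q : K[X]) :
    (Algebra.TensorProduct.lmul' K : A ⊗[K] A →ₐ[K] A) (aeval h.rootDiff q) =
      algebraMap K _ (q.eval 0) := by
  rw [← aeval_algHom_apply]
  simp [rootDiff, ← coeff_zero_eq_aeval_zero', coeff_zero_eq_eval_zero]

end IsAdjoinRoot

/-- If `x ⊗ 1 - 1 ⊗ x` is a root of `f ≠ 0` and `X ^ 2 ∣ f`, then no Hochschild cohomology module
of `A = K[X]/(f)` vanishes. -/
theorem IsAdjoinRoot.nontrivial_Ext_tensorProduct {K A : Type u} [Field K] [CommRing A]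
    [Algebra K A] [Module (A ⊗[K] A) A]
    (hsmul : ∀ (z : A ⊗[K] A) (a : A), z • a = Algebra.TensorProduct.lmul' K z * a)
    {f : K[X]} (h : IsAdjoinRoot A f) (hf : aeval h.rootDiff f = 0) (hf0 : f ≠ 0)
    (hX : X ^ 2 ∣ f) (m : ℕ) :
    Nontrivial (((Ext K (ModuleCat.{u} (A ⊗[K] A)) m).obj
      (Opposite.op (ModuleCat.of (A ⊗[K] A) A))).obj (ModuleCat.of (A ⊗[K] A) A)) := by
  obtain ⟨q, hq⟩ := hX
  have hXq : X * (X * q) = f := by rw [hq]; ring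
  have hq0 : X * q ≠ 0 := by
    rintro h0
    exact hf0 (by rw [← hXq, h0, mul_zero])
  have : Nontrivial A := by
    by_contra hA
    have := not_nontrivial_iff_subsingleton.1 hA
    have h1 : f ∣ 1 := h.map_eq_zero_iff.1 (Subsingleton.elim _ _)
    exact not_isUnit_X (isUnit_of_dvd_one ((Dvd.intro _ hXq).trans h1))
  let π : A ⊗[K] A →ₗ[A ⊗[K] A] A :=
    { (Algebra.TensorProduct.lmul' K : A ⊗[K] A →ₐ[K] A) with
      map_smul' := fun z w => by
        rw [RingHom.id_apply, hsmul]
        exact map_mul (Algebra.TensorProduct.lmul' K : A ⊗[K] A →ₐ[K] A) z w }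
  have e₁ := h.exact_mulLeft_aeval_rootDiff hf X_ne_zero hXq
  have e₂ := h.exact_mulLeft_aeval_rootDiff hf hq0 ((mul_comm _ _).trans hXq)
  rw [aeval_X] at e₁ e₂
  refine nontrivial_Ext_of_exact_pair (π := π) e₁ e₂ h.exact_mulLeft_rootDiff_lmul'
    (fun a => ⟨a ⊗ₜ 1, ?_⟩) (fun a => ?_) m
  · exact (Algebra.TensorProduct.lmul'_apply_tmul a 1).trans (mul_one a)
  · rw [hsmul, h.lmul'_aeval_rootDiff]
    simp

section PPolynomial

variable {K : Type*} [Field K] (p : ℕ) (s : Finset ℕ) (lam : ℕ → K)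

theorem Polynomial.aeval_sub_sum_C_mul_X_pow_pow [Fact p.Prime] [CharP K p] {S : Type*}
    [CommRing S] [Algebra K S] (a b : S) :
    aeval (a - b) (∑ i ∈ s, C (lam i) * X ^ p ^ i) =
      aeval a (∑ i ∈ s, C (lam i) * X ^ p ^ i) - aeval b (∑ i ∈ s, C (lam i) * X ^ p ^ i) := by
  nontriviality S
  have := charP_of_injective_algebraMap (algebraMap K S).injective p
  simp [sub_pow_char_pow, mul_sub]

theorem Polynomial.sum_C_mul_X_pow_pow_ne_zero (hp : 2 ≤ p) {n : ℕ} (hn : n ∈ s)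
    (hlam : lam n ≠ 0) : ∑ i ∈ s, C (lam i) * X ^ p ^ i ≠ 0 := by
  intro h
  have := congrArg (coeff · (p ^ n)) h
  simp [coeff_X_pow, Nat.pow_right_inj hp, hn, hlam] at this

end PPolynomial

set_option synthInstance.maxHeartbeats 1000000 in
/-- Let `K` be a field of prime characteristic `p` and
`f = λ₁ X^p + λ₂ X^{p²} + ⋯ + λₙ X^{pⁿ}` with `λₙ ≠ 0`. Then the Hochschild cohomology of
`A = K[X]/(f)` does not vanish in any degree: `Ext^m_{A ⊗ A}(A, A) ≠ 0` for every `m`. -/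
theorem hochschild_cohomology_nonvanishing (K : Type u) [Field K] (p : ℕ) [Fact p.Prime]
    [CharP K p] (n : ℕ) (hn : 1 ≤ n) (lam : ℕ → K) (hlam : lam n ≠ 0)
    (f : Polynomial K)
    (hf : f = ∑ i ∈ Finset.Icc 1 n, Polynomial.C (lam i) * Polynomial.X ^ (p ^ i))
    (m : ℕ) :
    Nontrivial (((Ext K (ModuleCat.{u} (QuotPolyAlg K f ⊗[K] QuotPolyAlg K f)) m).obj
      (Opposite.op (hochschildBimodule K f))).obj (hochschildBimodule K f)) := by
  have hp : p.Prime := Fact.out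
  have hf0 : f ≠ 0 :=
    hf ▸ sum_C_mul_X_pow_pow_ne_zero p _ lam hp.two_le (Finset.mem_Icc.2 ⟨hn, le_rfl⟩) hlam
  have hX : X ^ 2 ∣ f := by
    rw [hf]
    refine Finset.dvd_sum fun i hi => (pow_dvd_pow X ?_).mul_left _
    exact hp.two_le.trans (Nat.le_self_pow (Nat.one_le_iff_ne_zero.1 (Finset.mem_Icc.1 hi).1) p)
  let h : IsAdjoinRoot (QuotPolyAlg K f) f :=
    { map := Ideal.Quotient.mkₐ K (Ideal.span {f})
      map_surjective := Ideal.Quotient.mkₐ_surjective K _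
      ker_map := Ideal.Quotient.mkₐ_ker K _ }
  have hadd {S : Type u} [CommRing S] [Algebra K S] (a b : S) :
      aeval (a - b) f = aeval a f - aeval b f :=
    hf ▸ aeval_sub_sum_C_mul_X_pow_pow p _ lam a b
  have hd : aeval h.rootDiff f = 0 := by
    rw [IsAdjoinRoot.rootDiff, hadd, h.aeval_root_tmul_one, h.aeval_one_tmul_root,
      h.map_self, zero_tmul, tmul_zero, sub_zero]
  let := Module.compHom (QuotPolyAlg K f)
    ((Algebra.TensorProduct.lmul' K :
      QuotPolyAlg K f ⊗[K] QuotPolyAlg K f →ₐ[K] QuotPolyAlg K f)).toRingHom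
  exact IsAdjoinRoot.nontrivial_Ext_tensorProduct (fun _ _ => rfl) h hd hf0 hX m
end
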